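/- arXiv:1205.5001 — 2 statements merged into one kernel-verified Lean document; each statement's English description precedes it below -/
import Mathlib

section
/- Let p > 3 be prime, let θ : F_p → ℂ^* be a nontrivial additive character, let T be a multiplicative character of F_p with values in ℂ of order p−1 (a generator of the character group of F_p^*), and let a, b ∈ F_p^* with 4a³ + 27b² ≠ 0. Let E : y² = x³ + ax + b and a_p(E) := p − #{(x, y) ∈ F_p × F_p : y² = x³ + ax + b}. Then, as an identity in ℂ, a_p(E) = −φ(b)·p/(p−1) − (φ(−b)/(p(p−1))) · Σ_{j=1}^{p−2} g(T^{−j}) · g(T^{(p−1)/2 − 2j}) · g(T^{3j}) · g(T^{(p−1)/2}) · T^{j}(b²/a³). -/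
lemma MulChar.map_div {F : Type*} [Field F] (T : MulChar F ℂ) (x y : F) :
    T (x / y) = T x / T y :=
  map_div₀ T.toMonoidWithZeroHom x y

lemma MulChar.zpow_apply_units {F : Type*} [Field F] (T : MulChar F ℂ) (n : ℤ) (u : Fˣ) :
    (T ^ n) u = T u ^ n := by
  cases n with
  | ofNat n => simp [MulChar.pow_apply_coe]
  | negSucc n =>
    rw [zpow_negSucc, zpow_negSucc, MulChar.inv_apply_eq_inv', MulChar.pow_apply_coe]

section

open Finset

variable {F : Type*} [Field F] [Fintype F] [DecidableEq F]

/-- A multiplicative character of maximal order generates the character group. -/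
lemma MulChar.mem_zpowers_of_orderOf_eq {T : MulChar F ℂ}
    (hT : orderOf T = Fintype.card F - 1) (χ : MulChar F ℂ) : χ ∈ Subgroup.zpowers T := by
  have hcard : Nat.card (MulChar F ℂ) = Fintype.card F - 1 := by
    rw [MulChar.card_eq_card_units_of_hasEnoughRootsOfUnity, Nat.card_eq_fintype_card,
      Fintype.card_units]
  have htop : Subgroup.zpowers T = ⊤ := by
    apply Subgroup.eq_top_of_card_eq
    rw [Nat.card_zpowers, hT, hcard]
  rw [htop]
  exact Subgroup.mem_top χ

lemma MulChar.eq_one_of_orderOf_eq {T : MulChar F ℂ}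
    (hT : orderOf T = Fintype.card F - 1) {u : F} (hu : T u = 1) : u = 1 := by
  by_contra hne
  obtain ⟨χ, hχ⟩ := MulChar.exists_apply_ne_one_of_hasEnoughRootsOfUnity F ℂ hne
  obtain ⟨k, rfl⟩ := (mem_powers_iff_mem_zpowers).mpr (MulChar.mem_zpowers_of_orderOf_eq hT χ)
  have hu0 : u ≠ 0 := by
    rintro rfl
    simp at hu
  apply hχ
  rw [← Units.val_mk0 hu0, MulChar.pow_apply_coe, Units.val_mk0, hu, one_pow]

/-- Orthogonality of the powers of a generator of the character group. -/
lemma MulChar.sum_pow_apply_of_orderOf_eq {T : MulChar F ℂ}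
    (hT : orderOf T = Fintype.card F - 1) (u : Fˣ) :
    ∑ j ∈ range (Fintype.card F - 1), T u ^ j =
      if u = 1 then ((Fintype.card F - 1 : ℕ) : ℂ) else 0 := by
  split_ifs with h
  · simp [h]
  · have hne : T u ≠ 1 := fun hu ↦ h (Units.ext (MulChar.eq_one_of_orderOf_eq hT hu))
    rw [geom_sum_eq hne, ← MulChar.pow_apply_coe, ← hT, pow_orderOf_eq_one, MulChar.one_apply_coe,
      sub_self, zero_div]

/-- The quadratic character is the half power of any generator of the character group. -/
lemma MulChar.pow_half_eq_quadraticChar (hF : ringChar F ≠ 2) {T : MulChar F ℂ}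
    (hT : orderOf T = Fintype.card F - 1) :
    T ^ ((Fintype.card F - 1) / 2) = (quadraticChar F).ringHomComp (Int.castRingHom ℂ) := by
  obtain ⟨k, hk⟩ := (mem_powers_iff_mem_zpowers).mpr (MulChar.mem_zpowers_of_orderOf_eq hT
    ((quadraticChar F).ringHomComp (Int.castRingHom ℂ)))
  simp only at hk
  have hne : T ^ k ≠ 1 := by
    rw [hk, MulChar.ringHomComp_ne_one_iff Int.cast_injective]
    exact quadraticChar_ne_one hF
  have hsq : T ^ (2 * k) = 1 := by
    rw [mul_comm, pow_mul, hk]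
    exact ((quadraticChar_isQuadratic F).comp _).sq_eq_one
  have hdvd : Fintype.card F - 1 ∣ 2 * k := hT ▸ orderOf_dvd_of_pow_eq_one hsq
  have hndvd : ¬ Fintype.card F - 1 ∣ k := fun h ↦ hne (orderOf_dvd_iff_pow_eq_one.mp (hT ▸ h))
  obtain ⟨c, hc⟩ := hdvd
  have hcard : 2 * ((Fintype.card F - 1) / 2) = Fintype.card F - 1 := by
    have := FiniteField.odd_card_of_char_ne_two hF
    omega
  set m := (Fintype.card F - 1) / 2
  have hkm : k = m * c := by
    rw [← hcard, mul_assoc] at hc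
    exact Nat.eq_of_mul_eq_mul_left two_pos hc
  have hodd : c % 2 = 1 := by
    by_contra h
    refine hndvd ⟨c / 2, ?_⟩
    rw [← hcard, hkm, mul_assoc, mul_left_comm]
    congr 1
    omega
  have hT2 : T ^ (m * 2) = 1 := by rw [mul_comm, hcard, ← hT, pow_orderOf_eq_one]
  rw [← hk, hkm, ← Nat.div_add_mod c 2, hodd, mul_add, mul_one, ← mul_assoc, pow_add, pow_mul, hT2,
    one_pow, one_mul]

lemma sum_eq_zero_add_sum_units (f : F → ℂ) : ∑ x, f x = f 0 + ∑ u : Fˣ, f u := by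
  rw [Fintype.sum_eq_add_sum_subtype_ne f 0]
  congr 1
  exact (Fintype.sum_equiv unitsEquivNeZero _ _ fun u ↦ rfl).symm

lemma gaussSum_eq_sum_units (χ : MulChar F ℂ) (ψ : AddChar F ℂ) :
    gaussSum χ ψ = ∑ u : Fˣ, χ u * ψ u := by
  rw [gaussSum, sum_eq_zero_add_sum_units, MulChar.map_zero, zero_mul, zero_add]

/-- Expanding a sum of triple products of Gauss sums by orthogonality of characters. -/
lemma sum_gaussSum_mul_gaussSum_mul_gaussSum {T : MulChar F ℂ}
    (hT : orderOf T = Fintype.card F - 1) (χ : MulChar F ℂ) (ψ : AddChar F ℂ) (c : Fˣ) :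
    ∑ j ∈ range (Fintype.card F - 1), gaussSum (T ^ (-(j : ℤ))) ψ *
        gaussSum (χ * T ^ (-(2 * (j : ℤ)))) ψ * gaussSum (T ^ (3 * (j : ℤ))) ψ *
        (T ^ (j : ℤ)) c =
      ((Fintype.card F - 1 : ℕ) : ℂ) *
        ∑ y : Fˣ, ∑ z : Fˣ, χ y * ψ ((z ^ 3 * c / y ^ 2 : Fˣ) + y + z) := by
  have hterm (j : ℕ) : gaussSum (T ^ (-(j : ℤ))) ψ *
        gaussSum (χ * T ^ (-(2 * (j : ℤ)))) ψ * gaussSum (T ^ (3 * (j : ℤ))) ψ *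
        (T ^ (j : ℤ)) c = ∑ y : Fˣ, ∑ z : Fˣ, ∑ x : Fˣ,
          χ y * ψ (x + y + z) * T (z ^ 3 * c / y ^ 2 / x : Fˣ) ^ j := by
    simp only [gaussSum_eq_sum_units]
    rw [mul_comm (∑ u : Fˣ, (T ^ (-(j : ℤ))) u * ψ u), mul_assoc, mul_assoc, sum_mul]
    refine sum_congr rfl fun y _ ↦ ?_
    rw [mul_left_comm (∑ u : Fˣ, (T ^ (-(j : ℤ))) u * ψ u), sum_mul, mul_sum]
    refine sum_congr rfl fun z _ ↦ ?_
    rw [sum_mul, mul_sum, mul_sum]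
    refine sum_congr rfl fun x _ ↦ ?_
    have hT0 (u : Fˣ) : T u ≠ 0 := (u.isUnit.map T).ne_zero
    have hm : T (z ^ 3 * c / y ^ 2 / x : Fˣ) = T z ^ 3 * T c / T y ^ 2 / T x := by
      simp only [Units.val_mul, Units.val_pow_eq_pow_val, Units.val_div_eq_div_val,
        MulChar.map_div, map_mul T, map_pow T]
    rw [hm]
    simp only [MulChar.mul_apply, MulChar.zpow_apply_units, AddChar.map_add_eq_mul]
    simp only [zpow_neg, zpow_mul, zpow_natCast, zpow_ofNat]
    simp only [div_pow, mul_pow]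
    field_simp [hT0 x, hT0 y]
  simp_rw [hterm]
  rw [sum_comm, mul_sum]
  refine sum_congr rfl fun y _ ↦ ?_
  rw [sum_comm, mul_sum]
  refine sum_congr rfl fun z _ ↦ ?_
  rw [sum_comm]
  simp_rw [← mul_sum, MulChar.sum_pow_apply_of_orderOf_eq hT, div_eq_one]
  simp [mul_comm]

lemma MulChar.IsQuadratic.sum_mul_apply_mul {χ : MulChar F ℂ} (hχ : χ ≠ 1)
    (hq : χ.IsQuadratic) (ψ : AddChar F ℂ) (u : F) :
    ∑ t : Fˣ, χ t * ψ (u * t) = χ u * gaussSum χ ψ := by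
  have h : ∑ t : Fˣ, χ t * ψ (u * t) = gaussSum χ (ψ.mulShift u) := by
    simp [gaussSum_eq_sum_units, AddChar.mulShift_apply]
  rw [h]
  rcases eq_or_ne u 0 with rfl | hu
  · rw [AddChar.mulShift_zero, gaussSum_one_right hχ, MulChar.map_zero, zero_mul]
  · have := gaussSum_mulShift_eq χ ψ (Units.mk0 u hu)
    rwa [hq.inv, Units.val_mk0] at this

lemma card_sq_eq_eq_sum_quadraticChar (hF : ringChar F ≠ 2) (f : F → F) :
    (((univ.filter fun xy : F × F ↦ xy.2 ^ 2 = f xy.1).card : ℕ) : ℂ) =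
      Fintype.card F + ∑ x, ((quadraticChar F).ringHomComp (Int.castRingHom ℂ)) (f x) := by
  have h (x : F) : (((univ.filter fun y : F ↦ y ^ 2 = f x).card : ℕ) : ℤ) =
      quadraticChar F (f x) + 1 := by
    rw [← quadraticChar_card_sqrts hF (f x)]
    congr 2
    ext y
    simp
  have hsum : (univ.filter fun xy : F × F ↦ xy.2 ^ 2 = f xy.1).card =
      ∑ x, (univ.filter fun y : F ↦ y ^ 2 = f x).card := by
    simp only [card_filter, Fintype.sum_prod_type]
  have hz : (((univ.filter fun xy : F × F ↦ xy.2 ^ 2 = f xy.1).card : ℕ) : ℤ) =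
      Fintype.card F + ∑ x, quadraticChar F (f x) := by
    rw [hsum, Nat.cast_sum, sum_congr rfl fun x _ ↦ h x, sum_add_distrib]
    simp [add_comm]
  simpa [MulChar.ringHomComp_apply] using congrArg (Int.cast : ℤ → ℂ) hz

lemma MulChar.IsQuadratic.gaussSum_mul_sum_cubic {χ : MulChar F ℂ} (hχ : χ ≠ 1)
    (hq : χ.IsQuadratic) (ψ : AddChar F ℂ) (a b : Fˣ) :
    gaussSum χ ψ * ∑ x : F, χ (x ^ 3 + a * x + b) = χ b * gaussSum χ ψ +
      χ b * ∑ y : Fˣ, ∑ z : Fˣ,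
        χ y * ψ ((z ^ 3 * (b ^ 2 / a ^ 3) / y ^ 2 : Fˣ) + y + z) := by
  have hsplit : ∑ x : F, χ (x ^ 3 + a * x + b) =
      χ b + ∑ x : Fˣ, χ ((x : F) ^ 3 + a * x + b) := by
    rw [sum_eq_zero_add_sum_units]
    simp
  rw [hsplit, mul_add, mul_comm (gaussSum χ ψ), mul_comm (gaussSum χ ψ), sum_mul]
  congr 1
  simp_rw [← hq.sum_mul_apply_mul hχ ψ]
  rw [← Fintype.sum_prod_type', ← Fintype.sum_prod_type', mul_sum]
  let e : Fˣ × Fˣ ≃ Fˣ × Fˣ :=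
    { toFun := fun v ↦ (v.2 * b, v.2 * a * v.1)
      invFun := fun w ↦ (w.2 * b / (a * w.1), w.1 / b)
      left_inv := fun v ↦ by
        ext <;> simp <;> field_simp
      right_inv := fun w ↦ by
        ext <;> simp <;> field_simp }
  refine Fintype.sum_equiv e _ _ fun v ↦ ?_
  obtain ⟨x, t⟩ := v
  have hb2 : χ b * χ b = 1 := by
    rw [← map_mul, ← Units.val_mul, ← sq, Units.val_pow_eq_pow_val, map_pow, ← MulChar.pow_apply_coe,
      hq.sq_eq_one, MulChar.one_apply_coe]
  have harg : ((x : F) ^ 3 + a * x + b) * t =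
      (((t * a * x) ^ 3 * (b ^ 2 / a ^ 3) / (t * b) ^ 2 : Fˣ) : F) + (t * b : Fˣ) +
        (t * a * x : Fˣ) := by
    push_cast
    field_simp
    ring
  simp only [e, Equiv.coe_fn_mk]
  rw [← harg, Units.val_mul, map_mul χ, ← mul_assoc, mul_left_comm, hb2, mul_one]

end



/-- **Formula (4.4)**: for a prime `p > 3`, a nontrivial additive character `θ`, a generator
`T` of the character group of `𝔽_p^*`, and an elliptic curve `E : y² = x³ + ax + b` over `𝔽_p`,
`a_p(E) = -φ(b)p/(p-1) - (φ(-b)/(p(p-1)))·Σ_{j=1}^{p-2}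
          g(T^{-j})g(T^{(p-1)/2-2j})g(T^{3j})g(T^{(p-1)/2})T^{j}(b²/a³)`. -/
theorem trace_eq_gauss_sum_expansion (p : ℕ) [Fact p.Prime] (hp3 : 3 < p)
    (θ : AddChar (ZMod p) ℂ) (hθ : θ ≠ 1)
    (T : MulChar (ZMod p) ℂ) (hT : orderOf T = p - 1)
    (a b : ZMod p) (ha : a ≠ 0) (hb : b ≠ 0) (hns : 4 * a ^ 3 + 27 * b ^ 2 ≠ 0) :
    ((p : ℂ) -
        ((Finset.univ.filter
          (fun xy : ZMod p × ZMod p => xy.2 ^ 2 = xy.1 ^ 3 + a * xy.1 + b)).card : ℂ)) =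
      -((quadraticChar (ZMod p) b : ℂ) * (p : ℂ) / ((p : ℂ) - 1)) -
        ((quadraticChar (ZMod p) (-b) : ℂ) / ((p : ℂ) * ((p : ℂ) - 1))) *
          ∑ j ∈ Finset.Ico 1 (p - 1),
            gaussSum (T ^ (-(j : ℤ))) θ *
              gaussSum (T ^ ((((p - 1) / 2 : ℕ) : ℤ) - 2 * (j : ℤ))) θ *
              gaussSum (T ^ (3 * (j : ℤ))) θ *
              gaussSum (T ^ ((p - 1) / 2 : ℕ)) θ *
              (T ^ (j : ℤ)) (b ^ 2 / a ^ 3) := by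
  have hcard : Fintype.card (ZMod p) = p := ZMod.card p
  have hF : ringChar (ZMod p) ≠ 2 := by
    rw [ZMod.ringChar_zmod_n]
    omega
  have hp0 : (p : ℂ) ≠ 0 := by exact_mod_cast (by omega : p ≠ 0)
  have hp1 : (p : ℂ) - 1 ≠ 0 := sub_ne_zero.mpr (by exact_mod_cast (by omega : p ≠ 1))
  have hTcard : orderOf T = Fintype.card (ZMod p) - 1 := by rw [hcard, hT]
  have hhalf := MulChar.pow_half_eq_quadraticChar hF hTcard
  rw [hcard] at hhalf
  rw [card_sq_eq_eq_sum_quadraticChar hF fun x ↦ x ^ 3 + a * x + b, hcard]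
  have hφ (u : ZMod p) : (quadraticChar (ZMod p) u : ℂ) = (T ^ ((p - 1) / 2)) u := by
    rw [hhalf]
    rfl
  rw [hφ, hφ, ← hhalf]
  simp only [sub_eq_add_neg (((p - 1) / 2 : ℕ) : ℤ), zpow_add T, zpow_natCast T ((p - 1) / 2)]
  set χ := T ^ ((p - 1) / 2)
  have hq : χ.IsQuadratic := hhalf ▸ (quadraticChar_isQuadratic (ZMod p)).comp _
  have hχ : χ ≠ 1 := by
    rw [hhalf, MulChar.ringHomComp_ne_one_iff Int.cast_injective]
    exact quadraticChar_ne_one hF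
  have hg : gaussSum χ θ ^ 2 = χ (-1) * p := by
    rw [gaussSum_sq hχ hq (AddChar.IsPrimitive.of_ne_one hθ), hcard]
  have hneg : χ (-1) * χ (-1) = 1 := by
    rw [← map_mul]
    simp
  have hg0 : gaussSum χ θ ≠ 0 := by
    intro h
    rw [h, zero_pow two_ne_zero] at hg
    have h1 : χ (-1) ≠ 0 := left_ne_zero_of_mul_eq_one hneg
    exact mul_ne_zero h1 hp0 hg.symm
  obtain ⟨a, rfl⟩ := Ne.isUnit ha
  obtain ⟨b, rfl⟩ := Ne.isUnit hb
  have hcubic := hq.gaussSum_mul_sum_cubic hχ θ a b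
  have hsum := sum_gaussSum_mul_gaussSum_mul_gaussSum hTcard χ θ (b ^ 2 / a ^ 3)
  rw [hcard, Finset.range_eq_Ico, Finset.sum_eq_sum_Ico_succ_bot (by omega),
    Nat.cast_sub (by omega), Nat.cast_one] at hsum
  simp only [Nat.cast_zero, mul_zero, neg_zero, zpow_zero, mul_one, gaussSum_one_left hθ,
    zero_add, Units.val_div_eq_div_val, Units.val_pow_eq_pow_val] at hsum
  simp only [mul_right_comm _ (gaussSum χ θ), ← Finset.sum_mul]
  simp only [Units.val_div_eq_div_val, Units.val_pow_eq_pow_val, Units.val_mul] at hcubic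
  simp only [Units.val_mul, Units.val_div_eq_div_val, Units.val_pow_eq_pow_val] at hsum
  set W := ∑ y : (ZMod p)ˣ, ∑ z : (ZMod p)ˣ, χ y *
    θ ((z : ZMod p) ^ 3 * ((b : ZMod p) ^ 2 / (a : ZMod p) ^ 3) / (y : ZMod p) ^ 2 + y + z)
  set S := ∑ x : ZMod p, χ (x ^ 3 + a * x + b)
  set G := gaussSum χ θ
  set Z := ∑ i ∈ Finset.Ico 1 (p - 1), gaussSum (T ^ (-(i : ℤ))) θ *
    gaussSum (χ * T ^ (-(2 * (i : ℤ)))) θ * gaussSum (T ^ (3 * (i : ℤ))) θ *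
    (T ^ (i : ℤ)) ((b : ZMod p) ^ 2 / (a : ZMod p) ^ 3)
  have hone : (1 : MulChar (ZMod p) ℂ) ((b : ZMod p) ^ 2 / (a : ZMod p) ^ 3) = 1 := by
    rw [MulChar.one_apply]
    simp [ha, hb]
  rw [hone] at hsum
  have hnegb : χ (-(b : ZMod p)) = χ (-1) * χ b := by rw [← map_mul χ, neg_one_mul]
  have hS : S * (p * (p - 1)) = χ b * (p * p + χ (-1) * Z * G) := by
    apply mul_left_cancel₀ hg0
    linear_combination (p * (p - 1) : ℂ) * hcubic - χ b * p * hsum - χ b * χ (-1) * Z * hg -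
      χ b * Z * p * hneg
  rw [hnegb]
  field_simp
  linear_combination -hS
end

section
/- Let p = 3 and let a, b ∈ F_3^* (so the curve E : y² = x³ + ax² + b over F_3 has nonzero j-invariant). Let a_3(E) := 3 − #{(x, y) ∈ F_3 × F_3 : y² = x³ + ax² + b}. Then, as an identity in ℚ_3, a_3(E) = φ(a) · ₂G₂[0, 0; 0, 1/2 | −a/b]_3, where φ is the Legendre symbol modulo 3. -/
instance : Fact (Nat.Prime 3) := ⟨by norm_num⟩

/-- The rational `q`, regarded as a `p`-adic integer (when `q ∈ ℚ ∩ ℤ_p`). -/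
noncomputable def toZp (p : ℕ) [Fact p.Prime] (q : ℚ) : ℤ_[p] :=
  if h : ‖(q : ℚ_[p])‖ ≤ 1 then ⟨(q : ℚ_[p]), h⟩ else 0

/-- McCarthy's function `ₙGₙ[a₁,…,aₙ; b₁,…,bₙ | t]_p`. -/
noncomputable def padicG (p : ℕ) [Fact p.Prime] (Γ : ℤ_[p] → ℤ_[p])
    (ω : ZMod p → ℤ_[p]) (n : ℕ) (A B : Fin n → ℚ) (t : ZMod p) : ℚ_[p] :=
  -1 / ((p : ℚ_[p]) - 1) * ∑ j ∈ Finset.range (p - 1),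
    (-1 : ℚ_[p]) ^ (j * n) * ((((ω t : ℚ_[p]))⁻¹) ^ j) *
    ∏ i : Fin n,
      ((Γ (toZp p (Int.fract (A i - (j : ℚ) / ((p : ℚ) - 1)))) : ℚ_[p]) /
          (Γ (toZp p (Int.fract (A i))) : ℚ_[p]) *
        ((Γ (toZp p (Int.fract (-(B i) + (j : ℚ) / ((p : ℚ) - 1)))) : ℚ_[p]) /
          (Γ (toZp p (Int.fract (-(B i)))) : ℚ_[p])) *
        (-(p : ℚ_[p])) ^
          (-Int.floor (Int.fract (A i) - (j : ℚ) / ((p : ℚ) - 1)) -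
            Int.floor (Int.fract (-(B i)) + (j : ℚ) / ((p : ℚ) - 1))))

/-- The functional equation of Morita's `p`-adic gamma function. -/
theorem morita_gamma_add_one {p : ℕ} [Fact p.Prime] {Γ : ℤ_[p] → ℤ_[p]}
    (hΓcont : Continuous Γ) (hΓzero : Γ 0 = 1)
    (hΓnat : ∀ m : ℕ, 0 < m →
      Γ (m : ℤ_[p]) = (-1) ^ m * ∏ k ∈ (Finset.Ico 1 m).filter (fun k => ¬ p ∣ k), (k : ℤ_[p]))
    (x : ℤ_[p]) :
    (‖x‖ = 1 ∧ Γ (x + 1) = -x * Γ x) ∨ (‖x‖ ≤ (p : ℝ) ^ (-1 : ℤ) ∧ Γ (x + 1) = -Γ x) := by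
  induction x using PadicInt.denseRange_natCast.induction_on with
  | hp =>
    refine IsClosed.union ?_ ?_
    · exact (isClosed_eq continuous_norm continuous_const).inter
        (isClosed_eq (by fun_prop) (by fun_prop))
    · exact (isClosed_le continuous_norm continuous_const).inter
        (isClosed_eq (by fun_prop) (by fun_prop))
  | ih n =>
    rcases Nat.eq_zero_or_pos n with rfl | hn
    · have h := hΓnat 1 one_pos
      exact Or.inr (by simp_all)
    have h := hΓnat (n + 1) n.succ_pos
    rw [Nat.Ico_succ_right_eq_insert_Ico hn, Finset.filter_insert] at h
    push_cast at h
    by_cases hdvd : p ∣ n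
    · right
      constructor
      · have := (PadicInt.norm_int_le_pow_iff_dvd (p := p) (k := n) (n := 1)).2
          (by simpa using Int.natCast_dvd_natCast.2 hdvd)
        simpa using this
      · rw [h, hΓnat n hn, if_neg (not_not.2 hdvd)]
        ring
    · left
      constructor
      · refine le_antisymm (PadicInt.norm_le_one _) (not_lt.1 fun hlt => hdvd ?_)
        have := (PadicInt.norm_int_lt_one_iff_dvd (p := p) (n : ℤ)).1 (by simpa using hlt)
        exact Int.natCast_dvd_natCast.1 this
      · rw [h, hΓnat n hn, if_pos hdvd, Finset.prod_insert (by simp)]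
        ring

/-- The reflection formula for Morita's `p`-adic gamma function, up to sign. -/
theorem sq_morita_gamma_mul_one_sub {p : ℕ} [Fact p.Prime] {Γ : ℤ_[p] → ℤ_[p]}
    (hΓcont : Continuous Γ) (hΓzero : Γ 0 = 1)
    (hΓnat : ∀ m : ℕ, 0 < m →
      Γ (m : ℤ_[p]) = (-1) ^ m * ∏ k ∈ (Finset.Ico 1 m).filter (fun k => ¬ p ∣ k), (k : ℤ_[p]))
    (x : ℤ_[p]) : (Γ x * Γ (1 - x)) ^ 2 = 1 := by
  have hp : (p : ℝ) ^ (-1 : ℤ) < 1 := by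
    rw [zpow_neg_one]
    exact inv_lt_one_of_one_lt₀ (by exact_mod_cast (Fact.out : p.Prime).one_lt)
  have step (y : ℤ_[p]) : (Γ (y + 1) * Γ (1 - (y + 1))) ^ 2 = (Γ y * Γ (1 - y)) ^ 2 := by
    have h₁ := morita_gamma_add_one hΓcont hΓzero hΓnat y
    have h₂ := morita_gamma_add_one hΓcont hΓzero hΓnat (-y)
    rw [norm_neg, neg_add_eq_sub] at h₂
    rw [show 1 - (y + 1) = -y by ring]
    rcases h₁ with ⟨n₁, h₁⟩ | ⟨n₁, h₁⟩ <;> rcases h₂ with ⟨n₂, h₂⟩ | ⟨n₂, h₂⟩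
    · rw [h₁, h₂]; ring
    · linarith
    · linarith
    · rw [h₁, h₂]; ring
  induction x using PadicInt.denseRange_natCast.induction_on with
  | hp => exact isClosed_eq (by fun_prop) (by fun_prop)
  | ih n =>
    induction n with
    | zero =>
      have h := hΓnat 1 one_pos
      simp_all
    | succ n ih =>
      push_cast
      rw [step, ih]

theorem padicInt_three_sq_ne_neg_one (x : ℤ_[3]) : x ^ 2 ≠ -1 := by
  intro h
  have h' := congrArg (PadicInt.toZMod (p := 3)) h
  simp only [map_pow, map_neg, map_one] at h'
  revert h'
  generalize PadicInt.toZMod x = y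
  revert y
  decide

theorem toZp_zero (p : ℕ) [Fact p.Prime] : toZp p 0 = 0 := by
  apply Subtype.ext
  simp [toZp]

theorem two_mul_toZp_three_half : 2 * toZp 3 (1 / 2) = 1 := by
  have h : ‖((1 / 2 : ℚ) : ℚ_[3])‖ ≤ 1 :=
    Padic.norm_rat_le_one (by norm_num)
  have e : (toZp 3 (1 / 2) : ℚ_[3]) = ((1 / 2 : ℚ) : ℚ_[3]) :=
    congrArg Subtype.val (dif_pos h)
  apply Subtype.ext
  rw [two_mul, PadicInt.coe_add, e]
  push_cast
  norm_num

/-- The square of Morita's `3`-adic gamma function at `1/2` is `1`. -/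
theorem sq_morita_gamma_three_half {Γ : ℤ_[3] → ℤ_[3]}
    (hΓcont : Continuous Γ) (hΓzero : Γ 0 = 1)
    (hΓnat : ∀ m : ℕ, 0 < m →
      Γ (m : ℤ_[3]) = (-1) ^ m * ∏ k ∈ (Finset.Ico 1 m).filter (fun k => ¬ 3 ∣ k), (k : ℤ_[3])) :
    Γ (toZp 3 (1 / 2)) ^ 2 = 1 := by
  have h := sq_morita_gamma_mul_one_sub hΓcont hΓzero hΓnat (toZp 3 (1 / 2))
  rw [show 1 - toZp 3 (1 / 2) = toZp 3 (1 / 2) by linear_combination -two_mul_toZp_three_half,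
    ← sq] at h
  exact (mul_self_eq_one_iff.1 (by rw [← sq, h])).resolve_right (padicInt_three_sq_ne_neg_one _)

/-- Evaluation of `₂G₂[0, 0; 0, 1/2 | t]₃`. -/
theorem padicG_three_eq {Γ : ℤ_[3] → ℤ_[3]} (hΓzero : Γ 0 = 1)
    (hΓhalf : Γ (toZp 3 (1 / 2)) ^ 2 = 1) (ω : ZMod 3 → ℤ_[3]) (t : ZMod 3) :
    padicG 3 Γ ω 2 ![0, 0] ![0, 1/2] t = -1 / 2 * (1 - 3 * (ω t : ℚ_[3])⁻¹) := by
  have hsq : (Γ (toZp 3 (1 / 2)) : ℚ_[3]) ^ 2 = 1 := by exact_mod_cast congrArg Subtype.val hΓhalf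
  have hne : (Γ (toZp 3 (1 / 2)) : ℚ_[3]) ≠ 0 := by
    intro h
    rw [h] at hsq
    norm_num at hsq
  have f : Int.fract (-(1 / 2) : ℚ) = 1 / 2 := by
    rw [Int.fract_eq_iff]; exact ⟨by norm_num, by norm_num, -1, by norm_num⟩
  have f' : Int.fract (1 / 2 : ℚ) = 1 / 2 := by
    rw [Int.fract_eq_iff]; exact ⟨by norm_num, by norm_num, 0, by norm_num⟩
  have e : (((3 : ℕ) : ℚ) - 1) = 2 := by norm_num
  have fl : ⌊(1 / 2 : ℚ)⌋ = 0 := by norm_num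
  have fl' : ⌊(-(1 / 2) : ℚ)⌋ = -1 := by norm_num
  rw [padicG, Finset.sum_range_succ, Finset.sum_range_one]
  simp only [Fin.prod_univ_two, Matrix.cons_val_zero, Matrix.cons_val_one, e, Nat.cast_zero,
    Nat.cast_one, zero_div, zero_sub, sub_zero, neg_zero, add_zero, zero_add, Int.fract_zero,
    neg_add_cancel, toZp_zero, hΓzero, f, f', fl, fl', add_halves, Int.floor_zero, Int.floor_one]
  simp only [PadicInt.coe_one, div_one, div_self hne]
  norm_num
  linear_combination -3 * (ω t : ℚ_[3])⁻¹ * hsq -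
    3 * (ω t : ℚ_[3])⁻¹ * (Γ (toZp 3 (1 / 2)) : ℚ_[3]) ^ 2 * mul_inv_cancel₀ hne

/-- **The `p = 3` case**: for the curve `E : y² = x³ + ax² + b` over `𝔽_3` with
`a, b ∈ 𝔽_3^*`, one has `a₃(E) = φ(a) · ₂G₂[0, 0; 0, 1/2 | -a/b]₃` in `ℚ_3`.
Here `Γ` is Morita's `3`-adic gamma function and `ω` the Teichmüller character of `𝔽_3`. -/
theorem trace_of_frobenius_three (Γ : ℤ_[3] → ℤ_[3])
    (hΓcont : Continuous Γ) (hΓzero : Γ 0 = 1)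
    (hΓnat : ∀ m : ℕ, 0 < m →
      Γ (m : ℤ_[3]) = (-1) ^ m * ∏ k ∈ (Finset.Ico 1 m).filter (fun k => ¬ 3 ∣ k), (k : ℤ_[3]))
    (ω : ZMod 3 → ℤ_[3]) (hω0 : ω 0 = 0)
    (hωmul : ∀ x y : ZMod 3, ω (x * y) = ω x * ω y)
    (hωunit : ∀ x : ZMod 3, x ≠ 0 → IsUnit (ω x))
    (hωcong : ∀ x : ZMod 3, (3 : ℤ_[3]) ∣ (ω x - (x.val : ℤ_[3])))
    (a b : ZMod 3) (ha : a ≠ 0) (hb : b ≠ 0) :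
    ((3 : ℚ_[3]) -
        ((Finset.univ.filter
          (fun xy : ZMod 3 × ZMod 3 =>
            xy.2 ^ 2 = xy.1 ^ 3 + a * xy.1 ^ 2 + b)).card : ℚ_[3])) =
      (quadraticChar (ZMod 3) a : ℚ_[3]) *
        padicG 3 Γ ω 2 ![0, 0] ![0, 1/2] (-a / b) := by
  have h₁ : ω 1 = 1 := by
    have h := hωmul 1 1
    rw [mul_one] at h
    exact (hωunit 1 (by decide)).mul_left_cancel (by rw [← h, mul_one])
  have h₂ : ω 2 = -1 := by
    have h := hωmul 2 2
    rw [show (2 : ZMod 3) * 2 = 1 by decide, h₁] at h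
    refine (mul_self_eq_one_iff.1 h.symm).resolve_left fun h' => ?_
    have hdvd := hωcong 2
    rw [h', show (2 : ZMod 3).val = 2 by decide] at hdvd
    have hunit : IsUnit (3 : ℤ_[3]) :=
      isUnit_of_dvd_one (by simpa [show (1 : ℤ_[3]) - 2 = -1 by norm_num] using hdvd)
    exact PadicInt.prime_p.not_isUnit (by exact_mod_cast hunit)
  rw [padicG_three_eq hΓzero (sq_morita_gamma_three_half hΓcont hΓzero hΓnat)]
  have cases₃ (x : ZMod 3) (hx : x ≠ 0) : x = 1 ∨ x = 2 := by
    revert x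
    decide
  rcases cases₃ a ha with rfl | rfl <;> rcases cases₃ b hb with rfl | rfl
  · rw [show (-1 / 1 : ZMod 3) = 2 from (div_eq_iff (by decide)).2 (by decide), h₂,
      show quadraticChar (ZMod 3) 1 = 1 by decide]
    rw [show (Finset.univ.filter (fun xy : ZMod 3 × ZMod 3 =>
      xy.2 ^ 2 = xy.1 ^ 3 + 1 * xy.1 ^ 2 + 1)).card = 5 by decide]
    push_cast
    norm_num
  · rw [show (-1 / 2 : ZMod 3) = 1 from (div_eq_iff (by decide)).2 (by decide), h₁,
      show quadraticChar (ZMod 3) 1 = 1 by decide]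
    rw [show (Finset.univ.filter (fun xy : ZMod 3 × ZMod 3 =>
      xy.2 ^ 2 = xy.1 ^ 3 + 1 * xy.1 ^ 2 + 2)).card = 2 by decide]
    push_cast
    norm_num
  · rw [show (-2 / 1 : ZMod 3) = 1 from (div_eq_iff (by decide)).2 (by decide), h₁,
      show quadraticChar (ZMod 3) 2 = -1 by decide]
    rw [show (Finset.univ.filter (fun xy : ZMod 3 × ZMod 3 =>
      xy.2 ^ 2 = xy.1 ^ 3 + 2 * xy.1 ^ 2 + 1)).card = 4 by decide]
    push_cast
    norm_num
  · rw [show (-2 / 2 : ZMod 3) = 2 from (div_eq_iff (by decide)).2 (by decide), h₂,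
      show quadraticChar (ZMod 3) 2 = -1 by decide]
    rw [show (Finset.univ.filter (fun xy : ZMod 3 × ZMod 3 =>
      xy.2 ^ 2 = xy.1 ^ 3 + 2 * xy.1 ^ 2 + 2)).card = 1 by decide]
    push_cast
    norm_num
end
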